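/- arXiv:2111.14432 — 2 statements merged into one kernel-verified Lean document; each statement's English description precedes it below -/
import Mathlib

section
/- Let m, p be positive integers with m + p + 2 ≤ n. Let α be the partial injection of X_n with dom α = {1, …, m − 2} ∪ {m, …, m + p} ∪ {m + p + 4, …, n}, where xα = x for x ≤ m − 2 and for x ≥ m + p + 4, and xα = x + 2 for m ≤ x ≤ m + p. Then α ∈ ⟨J⟩ and α⁻¹ ∈ ⟨J⟩. -/
/-!
Common framework: partial injections on `X_n = {1, …, n}`, the fence order,
fence-preserving partial injections, the semigroups `PFI_n`, `IF_n`,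
the set `J` of elements of rank at least `n - 2`, and (for even `n`)
the generating system `G`.
-/

namespace FencePaper

/-- The fence (zigzag) order on `{1, …, n}`: `a <_f b` iff `|a - b| = 1` and `b` is even. -/
def fenceLt (a b : ℕ) : Prop := (a + 1 = b ∨ b + 1 = a) ∧ Even b

/-- A partial injection of `X_n = {1, …, n}`, given by its graph. -/
structure PartialInj (n : ℕ) where
  graph : Set (ℕ × ℕ)
  mem_le : ∀ p ∈ graph, 1 ≤ p.1 ∧ p.1 ≤ n ∧ 1 ≤ p.2 ∧ p.2 ≤ n
  functional : ∀ p ∈ graph, ∀ q ∈ graph, p.1 = q.1 → p.2 = q.2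
  injOn : ∀ p ∈ graph, ∀ q ∈ graph, p.2 = q.2 → p.1 = q.1

namespace PartialInj

variable {n : ℕ}

theorem ext' {α β : PartialInj n} (h : α.graph = β.graph) : α = β := by
  cases α
  cases β
  simp only at h
  subst h
  rfl

/-- The domain of a partial injection. -/
def dom (α : PartialInj n) : Set ℕ := {x | ∃ y, (x, y) ∈ α.graph}

/-- The image (range) of a partial injection. -/
def im (α : PartialInj n) : Set ℕ := {y | ∃ x, (x, y) ∈ α.graph}

/-- The rank of a partial injection: the cardinality of its image. -/
noncomputable def rank (α : PartialInj n) : ℕ := α.im.ncard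

/-- The inverse partial injection. -/
def inv (α : PartialInj n) : PartialInj n where
  graph := {p | (p.2, p.1) ∈ α.graph}
  mem_le := by
    rintro p hp
    obtain ⟨h1, h2, h3, h4⟩ := α.mem_le _ hp
    exact ⟨h3, h4, h1, h2⟩
  functional := by
    rintro p hp q hq h
    exact α.injOn _ hp _ hq h
  injOn := by
    rintro p hp q hq h
    exact α.functional _ hp _ hq h

/-- Composition: first `α`, then `β` (maps act on the right). -/
def comp (α β : PartialInj n) : PartialInj n where
  graph := {p | ∃ y, (p.1, y) ∈ α.graph ∧ (y, p.2) ∈ β.graph}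
  mem_le := by
    rintro p ⟨y, h1, h2⟩
    obtain ⟨a, b, -, -⟩ := α.mem_le _ h1
    obtain ⟨-, -, c, d⟩ := β.mem_le _ h2
    exact ⟨a, b, c, d⟩
  functional := by
    rintro p ⟨y, h1, h2⟩ q ⟨z, h3, h4⟩ h
    have hyz : y = z := α.functional _ h1 _ h3 h
    subst hyz
    exact β.functional (y, p.2) h2 (y, q.2) h4 rfl
  injOn := by
    rintro p ⟨y, h1, h2⟩ q ⟨z, h3, h4⟩ h
    have hyz : y = z := β.injOn _ h2 _ h4 h
    subst hyz
    exact α.injOn (p.1, y) h1 (q.1, y) h3 rfl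

/-- The partial identity map on `D ∩ {1, …, n}`. -/
def pid (n : ℕ) (D : Set ℕ) : PartialInj n where
  graph := {p | p.1 ∈ Set.Icc 1 n ∧ p.1 ∈ D ∧ p.2 = p.1}
  mem_le := by
    rintro p ⟨⟨h1, h2⟩, -, h3⟩
    refine ⟨h1, h2, ?_, ?_⟩ <;> omega
  functional := by
    rintro p ⟨-, -, h1⟩ q ⟨-, -, h2⟩ h
    rw [h1, h2, h]
  injOn := by
    rintro p ⟨-, -, h1⟩ q ⟨-, -, h2⟩ h
    rw [← h1, ← h2, h]

instance : Monoid (PartialInj n) where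
  mul := comp
  one := pid n (Set.Icc 1 n)
  mul_assoc a b c := by
    apply ext'
    ext q
    constructor
    · rintro ⟨y, ⟨z, h1, h2⟩, h3⟩
      exact ⟨z, h1, y, h2, h3⟩
    · rintro ⟨z, h1, y, h2, h3⟩
      exact ⟨y, ⟨z, h1, h2⟩, h3⟩
  one_mul a := by
    apply ext'
    ext q
    constructor
    · rintro ⟨y, ⟨-, -, h⟩, h2⟩
      have hy : y = q.1 := h
      rw [hy] at h2
      exact h2
    · intro hq
      obtain ⟨h1, h2, -, -⟩ := a.mem_le _ hq
      exact ⟨q.1, ⟨⟨h1, h2⟩, ⟨h1, h2⟩, rfl⟩, hq⟩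
  mul_one a := by
    apply ext'
    ext q
    constructor
    · rintro ⟨y, h1, ⟨-, -, h⟩⟩
      have hy : q.2 = y := h
      rw [← hy] at h1
      exact h1
    · intro hq
      obtain ⟨-, -, h3, h4⟩ := a.mem_le _ hq
      exact ⟨q.2, hq, ⟨h3, h4⟩, ⟨h3, h4⟩, rfl⟩

theorem mul_graph (α β : PartialInj n) :
    (α * β).graph = {p | ∃ y, (p.1, y) ∈ α.graph ∧ (y, p.2) ∈ β.graph} := rfl

/-- `α` is fence-preserving. -/
def FP (α : PartialInj n) : Prop :=
  ∀ p ∈ α.graph, ∀ q ∈ α.graph, fenceLt p.1 q.1 → fenceLt p.2 q.2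

/-- The image of a subset under a partial injection. -/
def imageOf (α : PartialInj n) (S : Set ℕ) : Set ℕ := {y | ∃ x ∈ S, (x, y) ∈ α.graph}

end PartialInj

open PartialInj

/-- `PFI_n`: the semigroup of all fence-preserving partial injections. -/
def PFIset (n : ℕ) : Set (PartialInj n) := {α | α.FP}

/-- `IF_n = {α ∈ PFI_n : α⁻¹ ∈ PFI_n}`. -/
def IFset (n : ℕ) : Set (PartialInj n) := {α | α.FP ∧ α.inv.FP}

/-- `J = {α ∈ IF_n : rank α ≥ n - 2}`. -/
def Jset (n : ℕ) : Set (PartialInj n) := {α | α ∈ IFset n ∧ n - 2 ≤ α.rank}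

/-- `A` is a maximal block of consecutive integers of `D ⊆ {1, …, n}`. -/
def IsBlock (n : ℕ) (D A : Set ℕ) : Prop :=
  ∃ i r : ℕ, 1 ≤ i ∧ A = Set.Icc i (i + r) ∧ A ⊆ D ∧
    (i = 1 ∨ i - 1 ∉ D) ∧ (i + r = n ∨ i + r + 1 ∉ D)

/-- `α(k)`: the maximal blocks of `dom α` of cardinality `k`. -/
def blockSet {n : ℕ} (α : PartialInj n) (k : ℕ) : Set (Set ℕ) :=
  {A | IsBlock n α.dom A ∧ A.ncard = k}

/-- `α°(2k+1)`: the maximal blocks `{i, …, i+2k}` of `dom α` with `i` odd. -/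
def oddBlockSet {n : ℕ} (α : PartialInj n) (k : ℕ) : Set (Set ℕ) :=
  {A | A ∈ blockSet α (2 * k + 1) ∧ Odd (sInf A)}

/-- The graph of `σ₁`: domain `X_n ∖ {2}`, `1 ↦ n`, `x ↦ x - 2` for `3 ≤ x ≤ n`. -/
def sigma1Graph (n : ℕ) : Set (ℕ × ℕ) :=
  {q | 1 ≤ q.1 ∧ q.1 ≤ n ∧ q.1 ≠ 2 ∧ q.2 = if q.1 = 1 then n else q.1 - 2}

/-- The graph of `σ₂ = σ₁⁻¹`: domain `X_n ∖ {n-1}`, `x ↦ x + 2` for `x ≤ n - 2`, `n ↦ 1`. -/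
def sigma2Graph (n : ℕ) : Set (ℕ × ℕ) :=
  {q | 1 ≤ q.1 ∧ q.1 ≤ n ∧ q.1 ≠ n - 1 ∧ q.2 = if q.1 = n then 1 else q.1 + 2}

/-- The graph of `γ_i`: domain `X_n ∖ {i}`, `x ↦ i - x` for `x < i`, `x ↦ x` for `x > i`. -/
def gammaGraph (n i : ℕ) : Set (ℕ × ℕ) :=
  {q | 1 ≤ q.1 ∧ q.1 ≤ n ∧ q.1 ≠ i ∧ q.2 = if q.1 < i then i - q.1 else q.1}

/-- The graph of `δ_i`: domain `X_n ∖ {i}`, `x ↦ x` for `x < i`, `x ↦ n + i + 1 - x` for `x > i`. -/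
def deltaGraph (n i : ℕ) : Set (ℕ × ℕ) :=
  {q | 1 ≤ q.1 ∧ q.1 ≤ n ∧ q.1 ≠ i ∧ q.2 = if q.1 < i then q.1 else n + i + 1 - q.1}

/-- The graph of `β_{i,j}`: domain `X_n ∖ {i, j}`, reversing the interval strictly
between `i` and `j` and fixing everything else. -/
def betaGraph (n i j : ℕ) : Set (ℕ × ℕ) :=
  {q | 1 ≤ q.1 ∧ q.1 ≤ n ∧ q.1 ≠ i ∧ q.1 ≠ j ∧
    q.2 = if i < q.1 ∧ q.1 < j then i + j - q.1 else q.1}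

/-- The generating system `G` (for even `n`), given elements `σ₁, σ₂` and families
`γ, δ` realizing the prescribed graphs. -/
def Gset (n : ℕ) (σ₁ σ₂ : PartialInj n) (γ δ : ℕ → PartialInj n) : Set (PartialInj n) :=
  {pid n (Set.Icc 1 n), σ₁, σ₂} ∪
    {g | ∃ i, Even i ∧ 4 ≤ i ∧ i ≤ n ∧ g = γ i} ∪
    {g | ∃ i, Odd i ∧ i ≤ n - 3 ∧ g = δ i}

namespace PartialInj

variable {n : ℕ}

theorem mem_inv {α : PartialInj n} {x y : ℕ} : (x, y) ∈ α.inv.graph ↔ (y, x) ∈ α.graph := Iff.rfl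

theorem mem_mul {α β : PartialInj n} {x z : ℕ} :
    (x, z) ∈ (α * β).graph ↔ ∃ y, (x, y) ∈ α.graph ∧ (y, z) ∈ β.graph := Iff.rfl

theorem mem_pid {D : Set ℕ} {x y : ℕ} :
    (x, y) ∈ (pid n D).graph ↔ (1 ≤ x ∧ x ≤ n) ∧ x ∈ D ∧ y = x := Iff.rfl

theorem inv_mul (α β : PartialInj n) : (α * β).inv = β.inv * α.inv := by
  apply ext'
  ext q
  exact exists_congr fun y => and_comm

theorem inv_pid (D : Set ℕ) : (pid n D).inv = pid n D := by
  apply ext'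
  ext ⟨x, y⟩
  rw [mem_inv, mem_pid, mem_pid]
  constructor <;>
  · rintro ⟨h, hD, rfl⟩
    exact ⟨h, hD, rfl⟩

theorem pid_FP (D : Set ℕ) : (pid n D).FP := by
  rintro ⟨x, x'⟩ ⟨-, -, hx⟩ ⟨y, y'⟩ ⟨-, -, hy⟩ h
  rwa [hx, hy]

theorem sub_two_le_rank (α : PartialInj n) (a b : ℕ)
    (h : ∀ y, 1 ≤ y → y ≤ n → y ≠ a → y ≠ b → y ∈ α.im) : n - 2 ≤ α.rank := by
  have hfin : α.im.Finite := by
    refine (Set.finite_Icc 1 n).subset ?_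
    rintro y ⟨x, hxy⟩
    exact (α.mem_le _ hxy).2.2
  have hsub : (((Finset.Icc 1 n) \ {a, b} : Finset ℕ) : Set ℕ) ⊆ α.im := by
    intro y hy
    simp only [Finset.coe_sdiff, Finset.coe_Icc, Finset.coe_insert, Finset.coe_singleton,
      Set.mem_sdiff, Set.mem_Icc, Set.mem_insert_iff, Set.mem_singleton_iff, not_or] at hy
    exact h y hy.1.1 hy.1.2 hy.2.1 hy.2.2
  have hcard := Set.ncard_le_ncard hsub hfin
  rw [Set.ncard_coe_finset] at hcard
  have hdiff := Finset.le_card_sdiff ({a, b} : Finset ℕ) (Finset.Icc 1 n)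
  have htwo : ({a, b} : Finset ℕ).card ≤ 2 := Finset.card_le_two
  rw [Nat.card_Icc] at hdiff
  unfold rank
  omega

/-- The partial injection that shifts `{1, …, k}` up by `2`, sends `k + 2` to `1`,
and fixes every point from `k + 4` on. -/
def initialShift (n k : ℕ) (hk : k + 2 ≤ n) : PartialInj n where
  graph := {q | (1 ≤ q.1 ∧ q.1 ≤ k ∧ q.2 = q.1 + 2) ∨ (q.1 = k + 2 ∧ q.2 = 1) ∨
    (k + 4 ≤ q.1 ∧ q.1 ≤ n ∧ q.2 = q.1)}
  mem_le := by
    rintro ⟨x, y⟩ h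
    simp only [Set.mem_ofPred_eq] at h ⊢
    omega
  functional := by
    rintro ⟨x, y⟩ h ⟨x', y'⟩ h' hx
    simp only [Set.mem_ofPred_eq] at h h' hx ⊢
    omega
  injOn := by
    rintro ⟨x, y⟩ h ⟨x', y'⟩ h' hy
    simp only [Set.mem_ofPred_eq] at h h' hy ⊢
    omega

theorem mem_initialShift {k : ℕ} {hk : k + 2 ≤ n} {x y : ℕ} :
    (x, y) ∈ (initialShift n k hk).graph ↔ (1 ≤ x ∧ x ≤ k ∧ y = x + 2) ∨
      (x = k + 2 ∧ y = 1) ∨ (k + 4 ≤ x ∧ x ≤ n ∧ y = x) := Iff.rfl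

theorem initialShift_FP {k : ℕ} (hk : k + 2 ≤ n) : (initialShift n k hk).FP := by
  rintro ⟨x, y⟩ h ⟨x', y'⟩ h'
  rw [mem_initialShift] at h h'
  simp only [fenceLt, Nat.even_iff]
  omega

theorem initialShift_inv_FP {k : ℕ} (hk : k + 2 ≤ n) : (initialShift n k hk).inv.FP := by
  rintro ⟨x, y⟩ h ⟨x', y'⟩ h'
  rw [mem_inv, mem_initialShift] at h h'
  simp only [fenceLt, Nat.even_iff]
  omega

/-- Both `α` and `α⁻¹` lie in the subsemigroup generated by `J`. -/
def BothInClosure (α : PartialInj n) : Prop :=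
  α ∈ Subsemigroup.closure (Jset n) ∧ α.inv ∈ Subsemigroup.closure (Jset n)

theorem BothInClosure.mul {α β : PartialInj n} (hα : α.BothInClosure) (hβ : β.BothInClosure) :
    (α * β).BothInClosure := by
  refine ⟨mul_mem hα.1 hβ.1, ?_⟩
  rw [inv_mul]
  exact mul_mem hβ.2 hα.2

theorem BothInClosure.symm {α : PartialInj n} (hα : α.BothInClosure) : α.inv.BothInClosure :=
  ⟨hα.2, hα.1⟩

theorem bothInClosure_initialShift {k : ℕ} (hk : k + 2 ≤ n) :
    (initialShift n k hk).BothInClosure := by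
  have hfp := initialShift_FP hk
  have hinv := initialShift_inv_FP hk
  constructor
  · refine Subsemigroup.subset_closure ⟨⟨hfp, hinv⟩, sub_two_le_rank _ 2 (k + 3) ?_⟩
    intro y h1 hn h2 h3
    refine ⟨if y = 1 then k + 2 else if y ≤ k + 2 then y - 2 else y, ?_⟩
    rw [mem_initialShift]
    split_ifs <;> omega
  · refine Subsemigroup.subset_closure ⟨⟨hinv, hfp⟩, sub_two_le_rank _ (k + 1) (k + 3) ?_⟩
    intro y h1 hn h2 h3
    refine ⟨if y ≤ k then y + 2 else if y = k + 2 then 1 else y, ?_⟩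
    rw [mem_inv, mem_initialShift]
    split_ifs <;> omega

theorem bothInClosure_pid_compl_singleton (k : ℕ) : (pid n {k}ᶜ).BothInClosure := by
  have hmem : pid n {k}ᶜ ∈ Subsemigroup.closure (Jset n) := by
    refine Subsemigroup.subset_closure ⟨⟨pid_FP _, ?_⟩, sub_two_le_rank _ k k ?_⟩
    · rw [inv_pid]
      exact pid_FP _
    · intro y h1 hn hk _
      exact ⟨y, ⟨h1, hn⟩, hk, rfl⟩
  refine ⟨hmem, ?_⟩
  rw [inv_pid]
  exact hmem

end PartialInj

/-- Lemma 2: the shift by `2` of the interval `{m, …, m+p}` lies in `⟨J⟩`. -/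
theorem lemma2 (n m p : ℕ) (hm : 1 ≤ m) (hp : 1 ≤ p) (hmp : m + p + 2 ≤ n)
    (α : PartialInj n)
    (hgraph : α.graph = {q : ℕ × ℕ |
      q.1 ∈ Set.Icc 1 (m - 2) ∪ Set.Icc m (m + p) ∪ Set.Icc (m + p + 4) n ∧
      q.2 = if m ≤ q.1 ∧ q.1 ≤ m + p then q.1 + 2 else q.1}) :
    α ∈ Subsemigroup.closure (Jset n) ∧ α.inv ∈ Subsemigroup.closure (Jset n) := by
  have hshift := (bothInClosure_pid_compl_singleton (n := n) (m + p + 2)).mul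
    (bothInClosure_initialShift hmp)
  rcases hm.eq_or_lt with rfl | hm2
  · suffices h : α = pid n {1 + p + 2}ᶜ * initialShift n (1 + p) hmp from h ▸ hshift
    apply ext'
    ext ⟨x, y⟩
    simp only [hgraph, mem_mul, mem_pid, mem_initialShift, Set.mem_ofPred_eq, Set.mem_union,
      Set.mem_Icc, Set.mem_compl_iff, Set.mem_singleton_iff]
    constructor
    · rintro ⟨hx, hy⟩
      refine ⟨x, ?_⟩
      split_ifs at hy <;> omega
    · rintro ⟨z, hz, hy⟩
      split_ifs <;> omega
  · have hk : m - 2 + 2 ≤ n := by omega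
    suffices h : α = pid n {m + p + 2}ᶜ * initialShift n (m + p) hmp *
        (initialShift n (m - 2) hk).inv from
      h ▸ hshift.mul (bothInClosure_initialShift hk).symm
    apply ext'
    ext ⟨x, y⟩
    simp only [hgraph, mem_mul, mem_inv, mem_pid, mem_initialShift, Set.mem_ofPred_eq,
      Set.mem_union, Set.mem_Icc, Set.mem_compl_iff, Set.mem_singleton_iff]
    constructor
    · rintro ⟨hx, hy⟩
      refine ⟨if x ≤ m + p then x + 2 else x, ⟨x, ?_⟩, ?_⟩ <;> split_ifs at hy ⊢ <;> omega
    · rintro ⟨w, ⟨z, hz, hw⟩, hy⟩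
      split_ifs <;> omega

end FencePaper
end

section
/- Let m, p be positive integers with p odd and m + p + 1 ≤ n. Let α be the partial injection of X_n with dom α = {1, …, m − 2} ∪ {m, …, m + p} ∪ {m + p + 3, …, n}, where xα = x for x ≤ m − 2 and for x ≥ m + p + 3, and xα = 2m + p + 1 − x for m ≤ x ≤ m + p (so mα = m + p + 1 and (m + p)α = m + 1). Then α ∈ ⟨J⟩ and α⁻¹ ∈ ⟨J⟩. -/
/-!
Common framework: partial injections on `X_n = {1, …, n}`, the fence order,
fence-preserving partial injections, the semigroups `PFI_n`, `IF_n`,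
the set `J` of elements of rank at least `n - 2`, and (for even `n`)
the generating system `G`.
-/

namespace FencePaper

open PartialInj

namespace PartialInj

variable {n : ℕ}

theorem le_rank_of_diff_pair_subset_im (α : PartialInj n) (i j : ℕ)
    (h : Set.Icc 1 n \ {i, j} ⊆ α.im) : n - 2 ≤ α.rank := by
  have him : α.im.Finite := by
    refine (Set.finite_Icc 1 n).subset ?_
    rintro y ⟨x, hx⟩
    exact (α.mem_le _ hx).2.2
  have hpair : ({i, j} : Set ℕ).ncard ≤ 2 := by
    simpa using Set.ncard_insert_le i {j}
  have hdiff := Set.le_ncard_sdiff ({i, j} : Set ℕ) (Set.Icc 1 n)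
  have hIcc : (Set.Icc 1 n).ncard = n := by
    rw [← Finset.coe_Icc, Set.ncard_coe_finset]
    simp
  have hle := Set.ncard_le_ncard h him
  unfold rank
  omega

/-- The partial injection `β_{i,j}`, reversing the interval strictly between `i` and `j`. -/
def reversal (n i j : ℕ) (hj : j ≤ n + 1) : PartialInj n where
  graph := betaGraph n i j
  mem_le := by
    rintro ⟨x, y⟩ ⟨h1, h2, h3, h4, h5⟩
    simp only at *
    split_ifs at h5 <;> omega
  functional := by
    rintro ⟨x, y⟩ ⟨-, -, -, -, h⟩ ⟨x', y'⟩ ⟨-, -, -, -, h'⟩ rfl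
    exact h.trans h'.symm
  injOn := by
    rintro ⟨x, y⟩ ⟨h1, h2, h3, h4, h5⟩ ⟨x', y'⟩ ⟨h1', h2', h3', h4', h5'⟩ h
    simp only at *
    split_ifs at h5 h5' <;> omega

theorem inv_reversal (i j : ℕ) (hj : j ≤ n + 1) :
    (reversal n i j hj).inv = reversal n i j hj := by
  apply ext'
  ext ⟨x, y⟩
  simp only [inv, reversal, betaGraph, Set.mem_ofPred_eq]
  constructor <;> rintro ⟨h1, h2, h3, h4, h5⟩ <;> split_ifs at h5 <;>
    refine ⟨by omega, by omega, by omega, by omega, ?_⟩ <;> split_ifs <;> omega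

theorem reversal_FP {i j : ℕ} (hj : j ≤ n + 1) (hij : Even (i + j)) :
    (reversal n i j hj).FP := by
  rintro ⟨x, y⟩ ⟨h1, h2, h3, h4, h5⟩ ⟨x', y'⟩ ⟨h1', h2', h3', h4', h5'⟩ ⟨h, he⟩
  simp only [fenceLt, Nat.even_iff] at *
  split_ifs at h5 h5' <;> omega

theorem reversal_mem_Jset {i j : ℕ} (hj : j ≤ n + 1) (hij : Even (i + j)) :
    reversal n i j hj ∈ Jset n := by
  refine ⟨⟨reversal_FP hj hij, ?_⟩, le_rank_of_diff_pair_subset_im _ i j ?_⟩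
  · rw [inv_reversal]
    exact reversal_FP hj hij
  · rintro y ⟨⟨h1, h2⟩, h3⟩
    simp only [Set.mem_insert_iff, Set.mem_singleton_iff, not_or] at h3
    refine ⟨if i < y ∧ y < j then i + j - y else y, ?_⟩
    rw [← inv_reversal]
    exact ⟨h1, h2, h3.1, h3.2, rfl⟩

theorem pid_compl_singleton_mem_Jset (k : ℕ) : pid n {k}ᶜ ∈ Jset n := by
  refine ⟨⟨pid_FP _, ?_⟩, le_rank_of_diff_pair_subset_im _ k k ?_⟩
  · rw [inv_pid]
    exact pid_FP _
  · rintro y ⟨hy, hk⟩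
    exact ⟨y, hy, by simpa using hk, rfl⟩

end PartialInj

/-- Lemma 3: with `p` odd, the reversing shift `x ↦ 2m + p + 1 - x` of `{m, …, m+p}`
lies in `⟨J⟩`. -/
theorem lemma3 (n m p : ℕ) (hm : 1 ≤ m) (hp : 1 ≤ p) (hpodd : Odd p)
    (hmp : m + p + 1 ≤ n) (α : PartialInj n)
    (hgraph : α.graph = {q : ℕ × ℕ |
      q.1 ∈ Set.Icc 1 (m - 2) ∪ Set.Icc m (m + p) ∪ Set.Icc (m + p + 3) n ∧
      q.2 = if m ≤ q.1 ∧ q.1 ≤ m + p then 2 * m + p + 1 - q.1 else q.1}) :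
    α ∈ Subsemigroup.closure (Jset n) ∧ α.inv ∈ Subsemigroup.closure (Jset n) := by
  have hj : m + p + 2 ≤ n + 1 := by omega
  have heven : Even (m - 1 + (m + p + 2)) := by
    rw [Nat.odd_iff] at hpodd
    rw [Nat.even_iff]
    omega
  have hα : α = pid n {m + p + 1}ᶜ * reversal n (m - 1) (m + p + 2) hj := by
    apply ext'
    rw [hgraph, mul_graph]
    ext ⟨x, y⟩
    simp only [pid, reversal, betaGraph, Set.mem_ofPred_eq, Set.mem_union, Set.mem_Icc,
      Set.mem_compl_iff, Set.mem_singleton_iff]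
    constructor
    · rintro ⟨hx, hy⟩
      refine ⟨x, ⟨by omega, by omega, rfl⟩, by omega, by omega, by omega, by omega, ?_⟩
      split_ifs at hy ⊢ <;> omega
    · rintro ⟨z, ⟨hx, hxk, rfl⟩, h1, h2, h3, h4, hy⟩
      refine ⟨by omega, ?_⟩
      split_ifs at hy ⊢ <;> omega
  have hpid := Subsemigroup.subset_closure (pid_compl_singleton_mem_Jset (n := n) (m + p + 1))
  have hrev := Subsemigroup.subset_closure (reversal_mem_Jset hj heven)
  rw [hα, inv_mul, inv_reversal, inv_pid]
  exact ⟨mul_mem hpid hrev, mul_mem hrev hpid⟩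

end FencePaper
end
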